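/- Let (X0,Y0) ∈ PPS be strongly efficient with all components positive and suppose (X0,Y0) is not of the directional smallest scale size. For t > 0 small enough that the set {β ∈ ℝ : (Ω_{−t} X0, Φ_{−β} Y0) ∈ PPS} is nonempty, let β₋(t) be its minimum. Then there exists t0 > 0 such that for every t ∈ (0, t0]: (1) the point (Ω_{−t} X0, Φ_{−β₋(t)} Y0) is weakly efficient, and (2) there exists a supporting hyperplane (V,U,μ0) of PPS with U ≥ 0 and V ≥ 0 componentwise that contains both (X0,Y0) and (Ω_{−t} X0, Φ_{−β₋(t)} Y0) (the hyperplane may depend on t). -/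

import Mathlib

open Finset Set

/-- The production possibility set (variable returns to scale):
`(X, Y) ∈ PPS` iff there are convex weights `lam` with
`Σ_j lam_j X_j ≤ X` and `Y ≤ Σ_j lam_j Y_j` componentwise. -/
def PPS {m s n : ℕ} (X : Fin n → Fin m → ℝ) (Y : Fin n → Fin s → ℝ) :
    Set ((Fin m → ℝ) × (Fin s → ℝ)) :=
  {p | ∃ lam : Fin n → ℝ, (∀ j, 0 ≤ lam j) ∧ (∑ j, lam j) = 1 ∧
    (∀ i, ∑ j, lam j * X j i ≤ p.1 i) ∧ (∀ r, p.2 r ≤ ∑ j, lam j * Y j r)}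

/-- Weak efficiency: no point of PPS strictly dominates in every coordinate. -/
def WeaklyEfficient {m s n : ℕ} (X : Fin n → Fin m → ℝ) (Y : Fin n → Fin s → ℝ)
    (p : (Fin m → ℝ) × (Fin s → ℝ)) : Prop :=
  p ∈ PPS X Y ∧ ¬ ∃ q ∈ PPS X Y, (∀ i, q.1 i < p.1 i) ∧ (∀ r, p.2 r < q.2 r)

/-- Strong (Pareto) efficiency. -/
def StronglyEfficient {m s n : ℕ} (X : Fin n → Fin m → ℝ) (Y : Fin n → Fin s → ℝ)
    (p : (Fin m → ℝ) × (Fin s → ℝ)) : Prop :=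
  p ∈ PPS X Y ∧ ¬ ∃ q ∈ PPS X Y, (∀ i, q.1 i ≤ p.1 i) ∧ (∀ r, p.2 r ≤ q.2 r) ∧ q ≠ p

/-- `(V, U, μ0)` is a supporting hyperplane of PPS at the point `p0`. -/
def SupportingHyperplane {m s n : ℕ} (X : Fin n → Fin m → ℝ) (Y : Fin n → Fin s → ℝ)
    (p0 : (Fin m → ℝ) × (Fin s → ℝ)) (V : Fin m → ℝ) (U : Fin s → ℝ) (μ0 : ℝ) : Prop :=
  (¬ (V = 0 ∧ U = 0)) ∧
  ((∑ r, U r * p0.2 r) - (∑ i, V i * p0.1 i) + μ0 = 0) ∧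
  (∀ p ∈ PPS X Y, (∑ r, U r * p.2 r) - (∑ i, V i * p.1 i) + μ0 ≤ 0)

/-- `Ω_t X0 = ((1 + ω_i t) x_{i0})_i`. -/
noncomputable def scaleX {m : ℕ} (ω : Fin m → ℝ) (t : ℝ) (X0 : Fin m → ℝ) : Fin m → ℝ :=
  fun i => (1 + ω i * t) * X0 i

/-- `Φ_β Y0 = ((1 + δ_r β) y_{r0})_r`. -/
noncomputable def scaleY {s : ℕ} (δ : Fin s → ℝ) (β : ℝ) (Y0 : Fin s → ℝ) : Fin s → ℝ :=
  fun r => (1 + δ r * β) * Y0 r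

/-- `(X0, Y0)` is of the directional smallest scale size:
`(Ω_t X0, Φ_β Y0) ∉ PPS` for every `t < 0` and every `β`. -/
def DSSS {m s n : ℕ} (X : Fin n → Fin m → ℝ) (Y : Fin n → Fin s → ℝ)
    (ω : Fin m → ℝ) (δ : Fin s → ℝ) (X0 : Fin m → ℝ) (Y0 : Fin s → ℝ) : Prop :=
  ∀ t < (0 : ℝ), ∀ β : ℝ, (scaleX ω t X0, scaleY δ β Y0) ∉ PPS X Y

/-- Feasible region `F` of the fractional program (Model 28): triples `(U, V, μ0)`. -/
def Fset {m s n : ℕ} (X : Fin n → Fin m → ℝ) (Y : Fin n → Fin s → ℝ)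
    (X0 : Fin m → ℝ) (Y0 : Fin s → ℝ) : Set ((Fin s → ℝ) × (Fin m → ℝ) × ℝ) :=
  {p | (∀ r, 0 ≤ p.1 r) ∧ (∀ i, 0 ≤ p.2.1 i) ∧
    (∀ j, (∑ r, p.1 r * Y j r) - (∑ i, p.2.1 i * X j i) + p.2.2 ≤ 0) ∧
    ((∑ r, p.1 r * Y0 r) - (∑ i, p.2.1 i * X0 i) + p.2.2 = 0) ∧
    ((∑ i, p.2.1 i * X0 i) = 1)}

/-- The fractional objective `(Σ_i v_i ω_i x_{i0}) / (Σ_r u_r δ_r y_{r0})` of Model (28). -/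
noncomputable def seRatio {m s : ℕ} (ω : Fin m → ℝ) (δ : Fin s → ℝ)
    (X0 : Fin m → ℝ) (Y0 : Fin s → ℝ) (p : (Fin s → ℝ) × (Fin m → ℝ) × ℝ) : ℝ :=
  (∑ i, p.2.1 i * ω i * X0 i) / (∑ r, p.1 r * δ r * Y0 r)

/-- Feasible region `G` of the linear program (Model 33): tuples `(Γ, Λ, τ, μ0')`. -/
def Gset {m s n : ℕ} (X : Fin n → Fin m → ℝ) (Y : Fin n → Fin s → ℝ)
    (ω : Fin m → ℝ) (δ : Fin s → ℝ) (X0 : Fin m → ℝ) (Y0 : Fin s → ℝ) :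
    Set ((Fin m → ℝ) × (Fin s → ℝ) × ℝ × ℝ) :=
  {q | (∀ i, 0 ≤ q.1 i) ∧ (∀ r, 0 ≤ q.2.1 r) ∧ 0 ≤ q.2.2.1 ∧
    (∀ j, (∑ r, q.2.1 r / δ r * Y j r) - (∑ i, q.1 i / ω i * X j i) + q.2.2.2 ≤ 0) ∧
    ((∑ r, q.2.1 r / δ r * Y0 r) - (∑ i, q.1 i / ω i * X0 i) + q.2.2.2 = 0) ∧
    ((∑ i, q.1 i / ω i * X0 i) = q.2.2.1) ∧
    ((∑ r, q.2.1 r * Y0 r) = 1)}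

/-- Over a polyhedron `{z | ∀ k, F k z ≤ b k}`, if every constraint active at a `B`-minimizer `x` of
its `T`-slice is active at `y`, then no point of an intermediate slice has a smaller `B`-value than
the corresponding point of the segment from `x` to `y`. -/
theorem segment_le_of_active_subset {E ι : Type*} [AddCommGroup E] [Module ℝ E] [Finite ι]
    (F : ι → E →ₗ[ℝ] ℝ) (b : ι → ℝ) (T B : E →ₗ[ℝ] ℝ) {x y z : E}
    (hx : ∀ k, F k x ≤ b k) (hact : ∀ k, F k x = b k → F k y = b k)
    (hmin : ∀ w, (∀ k, F k w ≤ b k) → T w = T x → B x ≤ B w)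
    {θ : ℝ} (hz : ∀ k, F k z ≤ b k) (hT : T z = (1 - θ) * T x + θ * T y) :
    (1 - θ) * B x + θ * B y ≤ B z := by
  set d : E := z - ((1 - θ) • x + θ • y) with hd
  have hFd (f : E →ₗ[ℝ] ℝ) : f d = f z - ((1 - θ) * f x + θ * f y) := by simp [hd]
  have hev : ∀ᶠ ε : ℝ in nhdsWithin 0 (Set.Ioi 0), ∀ k, F k (x + ε • d) ≤ b k := by
    rw [Filter.eventually_all]
    intro k
    rcases (hx k).lt_or_eq with hlt | heq
    · have hc : Filter.Tendsto (fun ε : ℝ => F k x + ε * F k d) (nhds 0)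
          (nhds (F k x + 0 * F k d)) := Continuous.tendsto (by fun_prop) 0
      have := (hc.eventually_lt_const (by simpa using hlt)).filter_mono
        (nhdsWithin_le_nhds (s := Set.Ioi 0))
      filter_upwards [this] with ε hε
      simpa using hε.le
    · filter_upwards [self_mem_nhdsWithin] with ε hε
      have hle : F k d ≤ 0 := by
        rw [hFd, hact k heq, heq]
        linarith [hz k]
      have := mul_nonpos_of_nonneg_of_nonpos (le_of_lt hε) hle
      simp only [map_add, map_smul, smul_eq_mul]
      linarith
  obtain ⟨ε, hε, hpos⟩ := (hev.and self_mem_nhdsWithin).exists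
  have h := hmin _ hε (by simp [hFd, hT])
  simp only [map_add, map_smul, smul_eq_mul] at h
  have hBd : 0 ≤ B d := nonneg_of_mul_nonneg_right (by linarith) hpos
  rw [hFd] at hBd
  linarith

/-- The value function of a one-parameter linear program is affine on some interval `(0, t₀]`. -/
theorem exists_affine_value_near_zero {E ι : Type*} [AddCommGroup E] [Module ℝ E] [Finite ι]
    (F : ι → E →ₗ[ℝ] ℝ) (b : ι → ℝ) (T B : E →ₗ[ℝ] ℝ) {g : ℝ → ℝ} {S : ℝ} (hS : 0 < S)
    (hatt : ∀ t ∈ Set.Ioc 0 S, ∃ z, (∀ k, F k z ≤ b k) ∧ T z = t ∧ B z = g t)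
    (hmin : ∀ z, (∀ k, F k z ≤ b k) → T z ∈ Set.Ioc 0 S → g (T z) ≤ B z) :
    ∃ t₀ ∈ Set.Ioc 0 S, ∃ a c : ℝ, ∀ t ∈ Set.Ioc 0 t₀, g t = a + c * t := by
  choose! z hzF hzT hzB using hatt
  have haff {u v : ℝ} (hu : u ∈ Set.Ioc 0 S) (hv : v ∈ Set.Ioc 0 S)
      (huv : u < v) (hact : {k | F k (z u) = b k} = {k | F k (z v) = b k}) {w : ℝ}
      (hw : w ∈ Set.Icc u v) :
      g w = g u + (w - u) * ((g v - g u) / (v - u)) := by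
    have hvu : 0 < v - u := sub_pos.2 huv
    have hwS : w ∈ Set.Ioc 0 S := ⟨hu.1.trans_le hw.1, hw.2.trans hv.2⟩
    set θ := (w - u) / (v - u) with hθ
    have hθ0 : 0 ≤ θ := div_nonneg (sub_nonneg.2 hw.1) hvu.le
    have hθ1 : θ ≤ 1 := (div_le_one hvu).2 (by linarith [hw.2])
    have hwθ : w = (1 - θ) * u + θ * v := by
      rw [hθ]; field_simp; ring
    have hlow := segment_le_of_active_subset F b T B (x := z u) (y := z v) (z := z w) (θ := θ)
      (hzF u hu) (fun k hk => (Set.ext_iff.1 hact k).1 hk)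
      (fun p hp hpT => by
        have := hmin p hp (by rw [hpT, hzT u hu]; exact hu)
        rwa [hpT, hzT u hu, ← hzB u hu] at this)
      (hzF w hwS) (by rw [hzT u hu, hzT v hv, hzT w hwS]; exact hwθ)
    have hTm : T ((1 - θ) • z u + θ • z v) = w := by
      simp [hzT u hu, hzT v hv, ← hwθ]
    have hup := hmin ((1 - θ) • z u + θ • z v)
      (fun k => by
        have h1 := mul_le_mul_of_nonneg_left (hzF u hu k) (sub_nonneg.2 hθ1)
        have h2 := mul_le_mul_of_nonneg_left (hzF v hv k) hθ0
        simp only [map_add, map_smul, smul_eq_mul]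
        linarith) (by rw [hTm]; exact hwS)
    rw [hTm] at hup
    rw [map_add, map_smul, map_smul, smul_eq_mul, smul_eq_mul] at hup
    rw [hzB u hu, hzB v hv] at hlow hup
    rw [hzB w hwS] at hlow
    have : (w - u) * ((g v - g u) / (v - u)) = θ * (g v - g u) := by rw [hθ]; ring
    rw [this]
    linarith
  obtain ⟨A, hA⟩ : ∃ A : Set ι, ∃ᶠ t in nhdsWithin (0 : ℝ) (Set.Ioi 0),
      {k | F k (z t) = b k} = A := by
    by_contra! h
    obtain ⟨t, ht⟩ := (Filter.eventually_all.2 h).exists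
    exact ht _ rfl
  have hfreq {u : ℝ} (hu : 0 < u) : ∃ t ∈ Set.Ioo 0 u, {k | F k (z t) = b k} = A := by
    obtain ⟨t, h1, h2⟩ := (hA.and_eventually (Ioo_mem_nhdsGT hu)).exists
    exact ⟨t, h2, h1⟩
  obtain ⟨t₀, ⟨ht₀, ht₀S⟩, hAt₀⟩ := hfreq hS
  set c := (g t₀ - g (t₀ / 2)) / (t₀ / 2) with hc
  refine ⟨t₀, ⟨ht₀, ht₀S.le⟩, g t₀ - c * t₀, c, fun t ht => ?_⟩
  obtain ⟨u, ⟨hu0, hu⟩, hAu⟩ := hfreq (lt_min ht.1 (half_pos ht₀))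
  have hut : u < t := hu.trans_le (min_le_left _ _)
  have hut₀ : u < t₀ / 2 := hu.trans_le (min_le_right _ _)
  have key {w : ℝ} := haff (w := w) ⟨hu0, by linarith⟩ ⟨ht₀, ht₀S.le⟩ (by linarith)
    (hAu.trans hAt₀.symm)
  have e1 := key (w := t) ⟨hut.le, ht.2⟩
  have e2 := key (w := t₀ / 2) ⟨hut₀.le, by linarith⟩
  have e3 := key (w := t₀) ⟨by linarith, le_rfl⟩
  set c' := (g t₀ - g u) / (t₀ - u)
  have hcc : c = c' := by
    rw [hc, e2, e3]
    field_simp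
    ring
  rw [hcc, e1]
  linarith

section PPS

variable {m s n : ℕ} {X : Fin n → Fin m → ℝ} {Y : Fin n → Fin s → ℝ}

theorem mem_PPS_of_dominated {p q : (Fin m → ℝ) × (Fin s → ℝ)} (hp : p ∈ PPS X Y)
    (h1 : ∀ i, p.1 i ≤ q.1 i) (h2 : ∀ r, q.2 r ≤ p.2 r) : q ∈ PPS X Y := by
  obtain ⟨l, hl0, hl1, hlX, hlY⟩ := hp
  exact ⟨l, hl0, hl1, fun i => (hlX i).trans (h1 i), fun r => (h2 r).trans (hlY r)⟩

theorem convex_PPS : Convex ℝ (PPS X Y) := by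
  rintro p ⟨l, hl0, hl1, hlX, hlY⟩ q ⟨l', hl0', hl1', hlX', hlY'⟩ a b ha hb hab
  have hsum (f : Fin n → ℝ) :
      ∑ j, (a * l j + b * l' j) * f j = a * ∑ j, l j * f j + b * ∑ j, l' j * f j := by
    rw [Finset.mul_sum, Finset.mul_sum, ← Finset.sum_add_distrib]
    exact Finset.sum_congr rfl fun j _ => by ring
  refine ⟨fun j => a * l j + b * l' j,
    fun j => add_nonneg (mul_nonneg ha (hl0 j)) (mul_nonneg hb (hl0' j)), ?_, fun i => ?_,
    fun r => ?_⟩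
  · rw [Finset.sum_add_distrib, ← Finset.mul_sum, ← Finset.mul_sum, hl1, hl1']
    linarith
  · rw [hsum]
    exact add_le_add (mul_le_mul_of_nonneg_left (hlX i) ha)
      (mul_le_mul_of_nonneg_left (hlX' i) hb)
  · rw [hsum]
    exact add_le_add (mul_le_mul_of_nonneg_left (hlY r) ha)
      (mul_le_mul_of_nonneg_left (hlY' r) hb)

theorem isClosed_PPS : IsClosed (PPS X Y) := by
  have : CompactSpace (stdSimplex ℝ (Fin n)) :=
    isCompact_iff_compactSpace.1 (isCompact_stdSimplex ℝ (Fin n))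
  have hC : IsClosed {w : stdSimplex ℝ (Fin n) × ((Fin m → ℝ) × (Fin s → ℝ)) |
      (∀ i, ∑ j, w.1.1 j * X j i ≤ w.2.1 i) ∧ ∀ r, w.2.2 r ≤ ∑ j, w.1.1 j * Y j r} := by
    have hl (j : Fin n) : Continuous fun w : stdSimplex ℝ (Fin n) ×
        ((Fin m → ℝ) × (Fin s → ℝ)) => w.1.1 j :=
      (continuous_apply j).comp (continuous_subtype_val.comp continuous_fst)
    simp only [Set.ofPred_and, Set.ofPred_forall]
    exact (isClosed_iInter fun i => isClosed_le
      (continuous_finsetSum _ fun j _ => (hl j).mul continuous_const) (by fun_prop)).inter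
        (isClosed_iInter fun r => isClosed_le (by fun_prop)
          (continuous_finsetSum _ fun j _ => (hl j).mul continuous_const))
  convert isClosedMap_snd_of_compactSpace _ hC using 1
  ext p
  constructor
  · rintro ⟨l, hl0, hl1, hlX, hlY⟩
    exact ⟨(⟨l, hl0, hl1⟩, p), ⟨hlX, hlY⟩, rfl⟩
  · rintro ⟨⟨l, q⟩, ⟨hlX, hlY⟩, rfl⟩
    exact ⟨l.1, l.2.1, l.2.2, hlX, hlY⟩

/-- Every weakly efficient point admits a supporting hyperplane with nonnegative coefficients. -/
theorem WeaklyEfficient.exists_supportingHyperplane {p : (Fin m → ℝ) × (Fin s → ℝ)}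
    (hp : WeaklyEfficient X Y p) :
    ∃ V : Fin m → ℝ, ∃ U : Fin s → ℝ, ∃ μ0 : ℝ,
      (∀ i, 0 ≤ V i) ∧ (∀ r, 0 ≤ U r) ∧ SupportingHyperplane X Y p V U μ0 := by
  obtain ⟨hpP, hdom⟩ := hp
  set O : Set ((Fin m → ℝ) × (Fin s → ℝ)) :=
    (Set.univ.pi fun i => Set.Iio (p.1 i)) ×ˢ (Set.univ.pi fun r => Set.Ioi (p.2 r)) with hO
  have hOopen : IsOpen O := (isOpen_set_pi Set.finite_univ fun i _ => isOpen_Iio).prod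
    (isOpen_set_pi Set.finite_univ fun r _ => isOpen_Ioi)
  have hOconv : Convex ℝ O := (convex_pi fun i _ => convex_Iio _).prod
    (convex_pi fun r _ => convex_Ioi _)
  have hdisj : Disjoint O (PPS X Y) := Set.disjoint_left.2 fun q hq hqP =>
    hdom ⟨q, hqP, fun i => hq.1 i trivial, fun r => hq.2 r trivial⟩
  obtain ⟨f, u, hfO, hfP⟩ := geometric_hahn_banach_open hOconv hOopen convex_PPS hdisj
  have hnear (ε : ℝ) (hε : 0 < ε) : ((fun i => p.1 i - ε, fun r => p.2 r + ε) :
      (Fin m → ℝ) × (Fin s → ℝ)) ∈ O :=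
    ⟨fun i _ => by simpa using hε, fun r _ => by simpa using hε⟩
  have hfp : f p = u := by
    refine le_antisymm ?_ (hfP p hpP)
    have hc : Filter.Tendsto (fun ε : ℝ => f (fun i => p.1 i - ε, fun r => p.2 r + ε))
        (nhdsWithin 0 (Set.Ioi 0)) (nhds (f (fun i => p.1 i - 0, fun r => p.2 r + 0))) :=
      (Continuous.tendsto (by fun_prop) 0).mono_left nhdsWithin_le_nhds
    simp only [sub_zero, add_zero] at hc
    exact le_of_tendsto hc (by
      filter_upwards [self_mem_nhdsWithin] with ε hε using (hfO _ (hnear ε hε)).le)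
  set V : Fin m → ℝ := fun i => f (Pi.single i 1, 0) with hV
  set U : Fin s → ℝ := fun r => - f (0, Pi.single r 1) with hU
  have hf (q : (Fin m → ℝ) × (Fin s → ℝ)) :
      f q = ∑ i, V i * q.1 i - ∑ r, U r * q.2 r := by
    have h1 : f q = f (q.1, 0) + f (0, q.2) := by rw [← map_add]; simp
    have h2 := (f.toLinearMap.comp (LinearMap.inl ℝ _ _)).pi_apply_eq_sum_univ q.1
    have h3 := (f.toLinearMap.comp (LinearMap.inr ℝ _ _)).pi_apply_eq_sum_univ q.2
    have hs1 {k : ℕ} (i : Fin k) :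
        (fun j => if i = j then (1 : ℝ) else 0) = Pi.single i 1 := by
      ext j; simp [Pi.single_apply, eq_comm]
    simp only [LinearMap.comp_apply, LinearMap.inl_apply, LinearMap.inr_apply,
      ContinuousLinearMap.coe_coe, smul_eq_mul, hs1] at h2 h3
    rw [h1, h2, h3]
    simp [hV, hU, mul_comm]
  refine ⟨V, U, u, fun i => ?_, fun r => ?_, ?_, ?_, fun q hq => ?_⟩
  · have h := hfP (p + (Pi.single i 1, 0)) (mem_PPS_of_dominated hpP
      (fun k => by simpa using (Pi.single_nonneg.2 zero_le_one : (0 : Fin m → ℝ) ≤ _) k)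
      (fun r => by simp))
    rw [map_add, hfp] at h
    simpa [hV] using h
  · have h := hfP (p - (0, Pi.single r 1)) (mem_PPS_of_dominated hpP (fun k => by simp)
      (fun k => by simpa using (Pi.single_nonneg.2 zero_le_one : (0 : Fin s → ℝ) ≤ _) k))
    rw [map_sub, hfp] at h
    simp only [hU]
    linarith
  · rintro ⟨hV0, hU0⟩
    have h := hfO _ (hnear 1 one_pos)
    rw [← hfp, hf, hf, hV0, hU0] at h
    simp at h
  · linarith [hf p]
  · linarith [hf q, hfP q hq]

/-- A supporting hyperplane at the midpoint of two points of `PPS` contains both of them. -/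
theorem SupportingHyperplane.endpoints {p q c : (Fin m → ℝ) × (Fin s → ℝ)}
    {V : Fin m → ℝ} {U : Fin s → ℝ} {μ0 : ℝ} (h : SupportingHyperplane X Y c V U μ0)
    (hp : p ∈ PPS X Y) (hq : q ∈ PPS X Y) (hc1 : ∀ i, c.1 i = (p.1 i + q.1 i) / 2)
    (hc2 : ∀ r, c.2 r = (p.2 r + q.2 r) / 2) :
    SupportingHyperplane X Y p V U μ0 ∧ SupportingHyperplane X Y q V U μ0 := by
  obtain ⟨h0, hc, hle⟩ := h
  have e1 : ∑ i, V i * c.1 i = (∑ i, V i * p.1 i + ∑ i, V i * q.1 i) / 2 := by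
    rw [← Finset.sum_add_distrib, Finset.sum_div]
    exact Finset.sum_congr rfl fun i _ => by rw [hc1]; ring
  have e2 : ∑ r, U r * c.2 r = (∑ r, U r * p.2 r + ∑ r, U r * q.2 r) / 2 := by
    rw [← Finset.sum_add_distrib, Finset.sum_div]
    exact Finset.sum_congr rfl fun r _ => by rw [hc2]; ring
  have hp' := hle p hp
  have hq' := hle q hq
  exact ⟨⟨h0, by linarith, hle⟩, ⟨h0, by linarith, hle⟩⟩

variable {ω : Fin m → ℝ} {δ : Fin s → ℝ} {X0 : Fin m → ℝ} {Y0 : Fin s → ℝ}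

theorem weaklyEfficient_of_isLeast {t β : ℝ}
    (h : IsLeast {β : ℝ | (scaleX ω (-t) X0, scaleY δ (-β) Y0) ∈ PPS X Y} β) :
    WeaklyEfficient X Y (scaleX ω (-t) X0, scaleY δ (-β) Y0) := by
  refine ⟨h.1, ?_⟩
  rintro ⟨q, hq, hq1, hq2⟩
  have hev : ∀ᶠ ε : ℝ in nhdsWithin 0 (Set.Ioi 0),
      ∀ r, scaleY δ (-(β - ε)) Y0 r < q.2 r := by
    rw [Filter.eventually_all]
    intro r
    have hc : Filter.Tendsto (fun ε : ℝ => scaleY δ (-(β - ε)) Y0 r) (nhds 0)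
        (nhds (scaleY δ (-(β - 0)) Y0 r)) :=
      Continuous.tendsto (by unfold scaleY; fun_prop) 0
    exact (hc.eventually_lt_const (by simpa using hq2 r)).filter_mono nhdsWithin_le_nhds
  obtain ⟨ε, hε, hpos⟩ := (hev.and self_mem_nhdsWithin).exists
  have hmem : β - ε ∈ {β : ℝ | (scaleX ω (-t) X0, scaleY δ (-β) Y0) ∈ PPS X Y} :=
    mem_PPS_of_dominated hq (fun i => (hq1 i).le) (fun r => (hε r).le)
  have := h.2 hmem
  have : 0 < ε := hpos
  linarith

/-- The set of parameters `(t, β)` for which the scaled point lies in `PPS` is convex. -/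
theorem convex_scale_mem_PPS :
    Convex ℝ {w : ℝ × ℝ | (scaleX ω (-w.1) X0, scaleY δ (-w.2) Y0) ∈ PPS X Y} := by
  intro w hw w' hw' a b ha hb hab
  have h := convex_PPS hw hw' ha hb hab
  have hb' : b = 1 - a := by linarith
  subst hb'
  have e : (scaleX ω (-(a • w + (1 - a) • w').1) X0, scaleY δ (-(a • w + (1 - a) • w').2) Y0) =
      a • (scaleX ω (-w.1) X0, scaleY δ (-w.2) Y0) +
        (1 - a) • (scaleX ω (-w'.1) X0, scaleY δ (-w'.2) Y0) := by
    ext k <;> simp [scaleX, scaleY] <;> ring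
  change _ ∈ PPS X Y
  rwa [e]

/-- The minimal output contraction is affine in the input contraction near zero. -/
theorem exists_affine_minimizer {βm : ℝ → ℝ} {S : ℝ} (hS : 0 < S)
    (hβm : ∀ t ∈ Set.Ioc 0 S,
      IsLeast {β : ℝ | (scaleX ω (-t) X0, scaleY δ (-β) Y0) ∈ PPS X Y} (βm t)) :
    ∃ t₀ ∈ Set.Ioc 0 S, ∃ a c : ℝ, ∀ t ∈ Set.Ioc 0 t₀, βm t = a + c * t := by
  let L (α γ : ℝ) (c : Fin n → ℝ) : (ℝ × ℝ × (Fin n → ℝ)) →ₗ[ℝ] ℝ :=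
    { toFun := fun z => α * z.1 + γ * z.2.1 + ∑ j, z.2.2 j * c j
      map_add' := fun z w => by
        simp only [Prod.fst_add, Prod.snd_add, Pi.add_apply, add_mul, Finset.sum_add_distrib]
        ring
      map_smul' := fun a z => by
        simp only [Prod.smul_fst, Prod.smul_snd, Pi.smul_apply, smul_eq_mul, RingHom.id_apply,
          mul_add, Finset.mul_sum, mul_assoc]
        ring }
  have hL (α γ : ℝ) (c : Fin n → ℝ) (z : ℝ × ℝ × (Fin n → ℝ)) :
      L α γ c z = α * z.1 + γ * z.2.1 + ∑ j, z.2.2 j * c j := rfl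
  let F : (Fin n ⊕ Bool) ⊕ (Fin m ⊕ Fin s) → (ℝ × ℝ × (Fin n → ℝ)) →ₗ[ℝ] ℝ :=
    Sum.elim
      (Sum.elim (fun j => L 0 0 (-Pi.single j 1)) (fun e => L 0 0 fun _ => if e then 1 else -1))
      (Sum.elim (fun i => L (ω i * X0 i) 0 fun j => X j i)
        (fun r => L 0 (-(δ r * Y0 r)) fun j => -Y j r))
  let b : (Fin n ⊕ Bool) ⊕ (Fin m ⊕ Fin s) → ℝ :=
    Sum.elim (Sum.elim (fun _ => 0) (fun e => if e then 1 else -1))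
      (Sum.elim (fun i => X0 i) (fun r => -Y0 r))
  have hF (z : ℝ × ℝ × (Fin n → ℝ)) : (∀ k, F k z ≤ b k) ↔
      (∀ j, 0 ≤ z.2.2 j) ∧ ∑ j, z.2.2 j = 1 ∧
      (∀ i, ∑ j, z.2.2 j * X j i ≤ scaleX ω (-z.1) X0 i) ∧
      (∀ r, scaleY δ (-z.2.1) Y0 r ≤ ∑ j, z.2.2 j * Y j r) := by
    simp only [Sum.forall, Bool.forall_bool, F, b, Sum.elim_inl, Sum.elim_inr, hL, scaleX, scaleY,
      le_antisymm_iff (a := ∑ j, z.2.2 j)]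
    simp only [Pi.neg_apply, mul_neg, Finset.sum_neg_distrib, Pi.single_apply, mul_ite, mul_one,
      mul_zero, Finset.sum_ite_eq', Finset.mem_univ, if_true, zero_mul, zero_add,
      Bool.false_eq_true, if_false, neg_nonpos, neg_le_neg_iff]
    constructor
    · rintro ⟨⟨h1, h2, h3⟩, h4, h5⟩
      exact ⟨h1, ⟨h3, h2⟩, fun i => by linarith [h4 i], fun r => by linarith [h5 r]⟩
    · rintro ⟨h1, ⟨h3, h2⟩, h4, h5⟩
      exact ⟨⟨h1, h2, h3⟩, fun i => by linarith [h4 i], fun r => by linarith [h5 r]⟩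
  refine exists_affine_value_near_zero F b (LinearMap.fst ℝ ℝ _)
    ((LinearMap.fst ℝ ℝ _).comp (LinearMap.snd ℝ ℝ _)) hS ?_ ?_
  · intro t ht
    obtain ⟨l, hl⟩ := (hβm t ht).1
    exact ⟨(t, βm t, l), (hF _).2 hl, rfl, rfl⟩
  · intro z hz hzT
    exact (hβm _ hzT).2 ⟨z.2.2, (hF z).1 hz⟩

end PPS

/-- Theorem 4 (left-hand): for all small enough t > 0, the minimizer point
(Ω_{-t} X0, Φ_{-β₋(t)} Y0) is weakly efficient and shares a (nonnegative)
supporting hyperplane of PPS with (X0, Y0). -/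
theorem left_hand_weak_efficiency_and_common_supporting_hyperplane
    {m s n : ℕ} (hm : 1 ≤ m) (hs : 1 ≤ s) (hn : 1 ≤ n)
    (X : Fin n → Fin m → ℝ) (Y : Fin n → Fin s → ℝ)
    (hX : ∀ j i, 0 < X j i) (hY : ∀ j r, 0 < Y j r)
    (ω : Fin m → ℝ) (δ : Fin s → ℝ)
    (hω : ∀ i, 0 ≤ ω i) (hδ : ∀ r, 0 ≤ δ r)
    (hωsum : (∑ i, ω i) = (m : ℝ)) (hδsum : (∑ r, δ r) = (s : ℝ))
    (X0 : Fin m → ℝ) (Y0 : Fin s → ℝ)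
    (hX0 : ∀ i, 0 < X0 i) (hY0 : ∀ r, 0 < Y0 r)
    (hse : StronglyEfficient X Y (X0, Y0))
    (hnd : ¬ DSSS X Y ω δ X0 Y0)
    (βm : ℝ → ℝ)
    (hβm : ∀ t : ℝ, 0 < t →
      {β : ℝ | (scaleX ω (-t) X0, scaleY δ (-β) Y0) ∈ PPS X Y}.Nonempty →
      IsLeast {β : ℝ | (scaleX ω (-t) X0, scaleY δ (-β) Y0) ∈ PPS X Y} (βm t)) :
    ∃ t0 > (0 : ℝ), ∀ t ∈ Set.Ioc (0 : ℝ) t0,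
      WeaklyEfficient X Y (scaleX ω (-t) X0, scaleY δ (-(βm t)) Y0) ∧
      ∃ V : Fin m → ℝ, ∃ U : Fin s → ℝ, ∃ μ0 : ℝ,
        (∀ i, 0 ≤ V i) ∧ (∀ r, 0 ≤ U r) ∧
        SupportingHyperplane X Y (X0, Y0) V U μ0 ∧
        (∑ r, U r * scaleY δ (-(βm t)) Y0 r) - (∑ i, V i * scaleX ω (-t) X0 i) + μ0 = 0 := by
  have hPP0 : (scaleX ω (-0) X0, scaleY δ (-0) Y0) = (X0, Y0) := by
    ext k <;> simp [scaleX, scaleY]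
  have h00 : ((0, 0) : ℝ × ℝ) ∈
      {w : ℝ × ℝ | (scaleX ω (-w.1) X0, scaleY δ (-w.2) Y0) ∈ PPS X Y} := by
    change (scaleX ω (-0) X0, scaleY δ (-0) Y0) ∈ PPS X Y
    rw [hPP0]
    exact hse.1
  obtain ⟨S, hS, β', hβ'⟩ : ∃ S > 0, ∃ β', ((S, β') : ℝ × ℝ) ∈
      {w : ℝ × ℝ | (scaleX ω (-w.1) X0, scaleY δ (-w.2) Y0) ∈ PPS X Y} := by
    unfold DSSS at hnd
    push Not at hnd
    obtain ⟨t, ht, β, h⟩ := hnd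
    exact ⟨-t, neg_pos.2 ht, -β, by simpa using h⟩
  have hleast (t : ℝ) (ht : t ∈ Set.Ioc 0 S) :
      IsLeast {β : ℝ | (scaleX ω (-t) X0, scaleY δ (-β) Y0) ∈ PPS X Y} (βm t) := by
    refine hβm t ht.1 ⟨t / S * β', ?_⟩
    have h := convex_scale_mem_PPS.smul_mem_of_zero_mem h00 hβ'
      ⟨(div_pos ht.1 hS).le, (div_le_one hS).2 ht.2⟩
    simpa [div_mul_cancel₀ _ hS.ne'] using h
  obtain ⟨t₀, ⟨ht₀, ht₀S⟩, a, c, hac⟩ := exists_affine_minimizer hS hleast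
  have hmem (t : ℝ) (ht : t ∈ Set.Ioc 0 t₀) :
      (scaleX ω (-t) X0, scaleY δ (-(a + c * t)) Y0) ∈ PPS X Y :=
    hac t ht ▸ (hleast t ⟨ht.1, ht.2.trans ht₀S⟩).1
  have ha_nonpos : a ≤ 0 := by
    have h := convex_scale_mem_PPS.smul_mem_of_zero_mem h00
      (x := (t₀, a + c * t₀)) (hmem t₀ ⟨ht₀, le_rfl⟩) (t := 1 / 2) ⟨by norm_num, by norm_num⟩
    have hhalf : 1 / 2 * (a + c * t₀) ∈
        {β : ℝ | (scaleX ω (-(t₀ / 2)) X0, scaleY δ (-β) Y0) ∈ PPS X Y} := by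
      rw [show t₀ / 2 = 1 / 2 * t₀ by ring]
      exact h
    have hle := (hleast (t₀ / 2) ⟨by linarith, by linarith⟩).2 hhalf
    rw [hac (t₀ / 2) ⟨by linarith, by linarith⟩] at hle
    linarith
  have ha_nonneg : 0 ≤ a := by
    by_contra! hneg
    have hlim : (X0, scaleY δ (-a) Y0) ∈ PPS X Y := by
      have hc : Filter.Tendsto (fun t : ℝ => (scaleX ω (-t) X0, scaleY δ (-(a + c * t)) Y0))
          (nhdsWithin 0 (Set.Ioi 0))
          (nhds (scaleX ω (-0) X0, scaleY δ (-(a + c * 0)) Y0)) :=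
        (Continuous.tendsto (by unfold scaleX scaleY; fun_prop) 0).mono_left nhdsWithin_le_nhds
      have h := isClosed_PPS.mem_of_tendsto hc (by
        filter_upwards [Ioc_mem_nhdsGT ht₀] with t ht using hmem t ht)
      rw [show scaleX ω (-0) X0 = X0 from (Prod.ext_iff.1 hPP0).1] at h
      simpa using h
    refine hse.2 ⟨_, hlim, fun i => le_rfl, fun r => ?_, fun heq => ?_⟩
    · have := mul_nonneg (mul_nonneg (hδ r) (neg_pos.2 hneg).le) (hY0 r).le
      simp only [scaleY]
      linarith
    · have hδ0 (r : Fin s) : δ r = 0 := by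
        have h := congrFun (Prod.ext_iff.1 heq).2 r
        simp only [scaleY] at h
        have h' : δ r * (a * Y0 r) = 0 := by linarith
        exact (mul_eq_zero.1 h').resolve_right (mul_ne_zero hneg.ne (hY0 r).ne')
      have : (s : ℝ) = 0 := by rw [← hδsum]; exact Finset.sum_eq_zero fun r _ => hδ0 r
      have : s = 0 := by exact_mod_cast this
      omega
  obtain rfl : a = 0 := le_antisymm ha_nonpos ha_nonneg
  refine ⟨t₀, ht₀, fun t ht => ?_⟩
  have htS : t ∈ Set.Ioc 0 S := ⟨ht.1, ht.2.trans ht₀S⟩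
  have ht2 : t / 2 ∈ Set.Ioc 0 t₀ := ⟨half_pos ht.1, by linarith [ht.1, ht.2]⟩
  refine ⟨weaklyEfficient_of_isLeast (hleast t htS), ?_⟩
  obtain ⟨V, U, μ0, hV, hU, hsup⟩ := (weaklyEfficient_of_isLeast
    (hleast (t / 2) ⟨ht2.1, ht2.2.trans ht₀S⟩)).exists_supportingHyperplane
  obtain ⟨h0, ht⟩ := hsup.endpoints hse.1 (hleast t htS).1
    (fun i => by simp only [scaleX]; ring)
    (fun r => by simp only [scaleY, hac t ht, hac _ ht2]; ring)
  exact ⟨V, U, μ0, hV, hU, h0, ht.2.1⟩
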